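/- For the control problem of Example 4 (T = [0,3], U the set of Borel measurable controls with values in [−1,1], V = {v₁, v₂}, and for ρ ∈ ℝ the multifunction α_ρ(v) := {u ∈ U : |∫₀³ (u(s) + v(s)) ds| ≥ −ρ}), the following holds: α_ρ has a {[0,1]}-non-anticipative multiselector with nonempty values (i.e., N°_{{[0,1]}}(α_ρ) ≠ ∅) if and only if ρ ≥ −7/2. In particular, the optimal guaranteed result in the class of non-anticipative strategies equals −7/2. -/

import Mathlib

open Set

/-- Restriction of a set `F` of functions (elements of `Z`) to the set `A ⊆ T`:
`F|_A = {f|_A : f ∈ F}`. -/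
def resSet {T X : Type*} {Z : Set (T → X)} (A : Set T) (F : Set ↥Z) : Set (↥A → X) :=
  (fun h : ↥Z => A.restrict (h : T → X)) '' F

/-- A multifunction `z : Ω → 𝒫(Z)` is `A`-non-anticipative if `ω|_A = ω'|_A` implies
`z(ω)|_A = z(ω')|_A`. -/
def NonAnt {T X Y : Type*} (Ω : Set (T → Y)) (Z : Set (T → X)) (A : Set T)
    (z : ↥Ω → Set ↥Z) : Prop :=
  ∀ ω ω' : ↥Ω, A.restrict (ω : T → Y) = A.restrict (ω' : T → Y) →
    resSet A (z ω) = resSet A (z ω')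

/-- `N_ℋ(α)`: the set of `ℋ`-non-anticipative multiselectors of `α`. -/
def Nna {T X Y : Type*} (Ω : Set (T → Y)) (Z : Set (T → X)) (ℋ : Set (Set T))
    (α : ↥Ω → Set ↥Z) : Set (↥Ω → Set ↥Z) :=
  {z | (∀ A ∈ ℋ, NonAnt Ω Z A z) ∧ ∀ ω, z ω ⊆ α ω}

/-- `N°_ℋ(α)`: the set of nonempty-valued `ℋ`-non-anticipative multiselectors of `α`. -/
def NnaNE {T X Y : Type*} (Ω : Set (T → Y)) (Z : Set (T → X)) (ℋ : Set (Set T))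
    (α : ↥Ω → Set ↥Z) : Set (↥Ω → Set ↥Z) :=
  {z ∈ Nna Ω Z ℋ α | ∀ ω, (z ω).Nonempty}

/-- The operator `Γ_A`:
`Γ_A(α)(ω) = {h ∈ α(ω) : h|_A ∈ ⋂_{ω' ∈ Ω, ω'|_A = ω|_A} α(ω')|_A}`. -/
def Gamma {T X Y : Type*} (Ω : Set (T → Y)) (Z : Set (T → X)) (A : Set T)
    (α : ↥Ω → Set ↥Z) : ↥Ω → Set ↥Z :=
  fun ω => {h ∈ α ω |
    A.restrict (h : T → X) ∈
      ⋂ ω' ∈ {η : ↥Ω | A.restrict (η : T → Y) = A.restrict (ω : T → Y)}, resSet A (α ω')}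

/-- Example 4: the time interval `T = [0,3]`. -/
abbrev Tex4 : Type := ↥(Set.Icc (0:ℝ) 3)

/-- Example 4: the set `U` of admissible controls: Borel measurable functions with values in
`[-1, 1]`. -/
def Uex4 : Set (Tex4 → ℝ) := {u | Measurable u ∧ ∀ t, u t ∈ Set.Icc (-1:ℝ) 1}

/-- Example 4: the disturbance `v₁`. -/
noncomputable def v1ex4 : Tex4 → ℝ := fun t => if 1 < (t : ℝ) ∧ (t : ℝ) ≤ 2 then 1 else 0

/-- Example 4: the disturbance `v₂`. -/
noncomputable def v2ex4 : Tex4 → ℝ := fun t => if 1 < (t : ℝ) then -1 else 0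

/-- Example 4: the set of admissible disturbances `V = {v₁, v₂}`. -/
noncomputable def Vex4 : Set (Tex4 → ℝ) := {v1ex4, v2ex4}

/-- Example 4: the multifunction `α_ρ` of `ρ`-optimal answers:
`α_ρ(v) = {u ∈ U : |∫₀³ (u(s) + v(s)) ds| ≥ -ρ}`. -/
noncomputable def αex4 (ρ : ℝ) : ↥Vex4 → Set ↥Uex4 := fun v =>
  {u | -ρ ≤ |∫ t : Tex4, ((u : Tex4 → ℝ) t + (v : Tex4 → ℝ) t)
      ∂(MeasureTheory.volume.comap Subtype.val)|}

open MeasureTheory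

noncomputable def muex4 : Measure Tex4 := Measure.comap Subtype.val volume

lemma muex4_apply (s : Set ℝ) : 
    muex4.real {t : Tex4 | (t : ℝ) ∈ s} = (volume (s ∩ Icc (0:ℝ) 3)).toReal := by
  have he : MeasurableEmbedding (Subtype.val : Tex4 → ℝ) :=
    MeasurableEmbedding.subtype_coe measurableSet_Icc
  unfold muex4
  rw [Measure.real, he.comap_apply]
  congr 2
  have : {t : Tex4 | (t : ℝ) ∈ s} = Subtype.val ⁻¹' s := rfl
  rw [this, Subtype.image_preimage_coe, Set.inter_comm]

instance : IsFiniteMeasure muex4 := by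
  have he : MeasurableEmbedding (Subtype.val : Tex4 → ℝ) :=
    MeasurableEmbedding.subtype_coe measurableSet_Icc
  refine ⟨?_⟩
  unfold muex4
  rw [he.comap_apply, Set.image_univ, Subtype.range_coe, Real.volume_Icc]
  exact ENNReal.ofReal_lt_top

def Aex4 : Set Tex4 := {t : Tex4 | (t : ℝ) ≤ 1}
def Bex4 : Set Tex4 := {t : Tex4 | 1 < (t : ℝ) ∧ (t : ℝ) ≤ 2}

lemma measA : MeasurableSet Aex4 := measurableSet_le measurable_subtype_coe measurable_const
lemma measB : MeasurableSet Bex4 :=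
  (measurableSet_lt measurable_const measurable_subtype_coe).inter
    (measurableSet_le measurable_subtype_coe measurable_const)

lemma muA : muex4.real Aex4 = 1 := by
  have := muex4_apply (Iic 1)
  have h : Iic (1:ℝ) ∩ Icc 0 3 = Icc 0 1 := by
    ext x; simp only [mem_inter_iff, mem_Iic, mem_Icc]; grind
  rw [h] at this
  have h2 : Aex4 = {t : Tex4 | (t : ℝ) ∈ Iic (1:ℝ)} := rfl
  rw [h2, this, Real.volume_Icc, ENNReal.toReal_ofReal] <;> norm_num

lemma muAc : muex4.real Aex4ᶜ = 2 := by
  have := muex4_apply (Ioi 1)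
  have h : Ioi (1:ℝ) ∩ Icc 0 3 = Ioc 1 3 := by
    ext x; simp only [mem_inter_iff, mem_Ioi, mem_Icc, mem_Ioc]; grind
  have h2 : Aex4ᶜ = {t : Tex4 | (t : ℝ) ∈ Ioi (1:ℝ)} := by
    ext t; simp [Aex4]
  rw [h2, this, h, Real.volume_Ioc, ENNReal.toReal_ofReal] <;> norm_num

lemma muB : muex4.real Bex4 = 1 := by
  have := muex4_apply (Ioc 1 2)
  have h : Ioc (1:ℝ) 2 ∩ Icc 0 3 = Ioc 1 2 := by
    ext x; simp only [mem_inter_iff, mem_Icc, mem_Ioc]; grind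
  have h2 : Bex4 = {t : Tex4 | (t : ℝ) ∈ Ioc (1:ℝ) 2} := rfl
  rw [h2, this, h, Real.volume_Ioc, ENNReal.toReal_ofReal] <;> norm_num

lemma v1_eq : v1ex4 = Bex4.indicator (fun _ => (1:ℝ)) := by
  ext t
  by_cases h : 1 < (t : ℝ) ∧ (t : ℝ) ≤ 2
  · rw [indicator_of_mem (show t ∈ Bex4 from h)]; exact if_pos h
  · rw [indicator_of_notMem (show t ∉ Bex4 from h)]; exact if_neg h

lemma v2_eq : v2ex4 = Aex4ᶜ.indicator (fun _ => (-1:ℝ)) := by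
  ext t; simp [v2ex4, Aex4, indicator]

lemma int_v1 : Integrable v1ex4 muex4 := by
  rw [v1_eq]; exact (integrable_const _).indicator measB

lemma int_v2 : Integrable v2ex4 muex4 := by
  rw [v2_eq]; exact (integrable_const _).indicator measA.compl

lemma integral_v1 : ∫ t, v1ex4 t ∂muex4 = 1 := by
  rw [v1_eq, integral_indicator_const _ measB, muB]; simp

lemma integral_v2 : ∫ t, v2ex4 t ∂muex4 = -2 := by
  rw [v2_eq, integral_indicator_const _ measA.compl, muAc]; simp

lemma int_u (u : Tex4 → ℝ) (hu : u ∈ Uex4) : Integrable u muex4 :=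
  Integrable.of_bound hu.1.aestronglyMeasurable 1
    (Filter.Eventually.of_forall fun t => abs_le.2 (hu.2 t))

lemma split1 (u : Tex4 → ℝ) (hu : u ∈ Uex4) :
    ∫ t, (u t + v1ex4 t) ∂muex4 = ∫ t in Aex4, u t ∂muex4 + ∫ t in Aex4ᶜ, u t ∂muex4 + 1 := by
  rw [integral_add (int_u u hu) int_v1, integral_v1, integral_add_compl measA (int_u u hu)]

lemma split2 (u : Tex4 → ℝ) (hu : u ∈ Uex4) :
    ∫ t, (u t + v2ex4 t) ∂muex4 = ∫ t in Aex4, u t ∂muex4 + ∫ t in Aex4ᶜ, u t ∂muex4 + -2 := by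
  rw [integral_add (int_u u hu) int_v2, integral_v2, integral_add_compl measA (int_u u hu)]

lemma bound (u : Tex4 → ℝ) (hu : u ∈ Uex4) (s : Set Tex4) :
    |∫ t in s, u t ∂muex4| ≤ muex4.real s := by
  have := norm_setIntegral_le_of_norm_le_const (μ := muex4) (s := s) (f := u) (C := 1)
    (measure_lt_top _ _) (fun t _ => abs_le.2 (hu.2 t))
  simpa using this

/-- The control equal to `1/2` on `[0,1]` and to `c` afterwards. -/
noncomputable def uex4 (c : ℝ) : Tex4 → ℝ := fun t => if (t : ℝ) ≤ 1 then 1/2 else c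

lemma uex4_mem (c : ℝ) (hc : c ∈ Icc (-1:ℝ) 1) : uex4 c ∈ Uex4 := by
  refine ⟨Measurable.ite measA measurable_const measurable_const, fun t => ?_⟩
  unfold uex4
  split_ifs
  · constructor <;> norm_num
  · exact hc

lemma uex4_A (c : ℝ) : ∫ t in Aex4, uex4 c t ∂muex4 = 1/2 := by
  rw [setIntegral_congr_fun (f := uex4 c) (g := fun _ => (1/2:ℝ)) measA (fun t ht => if_pos ht)]
  simp [muA]

lemma uex4_Ac (c : ℝ) : ∫ t in Aex4ᶜ, uex4 c t ∂muex4 = 2 * c := by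
  rw [setIntegral_congr_fun (f := uex4 c) (g := fun _ => c) measA.compl (fun t ht => if_neg ht)]
  simp [muAc]

lemma restr_eq : Aex4.restrict v1ex4 = Aex4.restrict v2ex4 := by
  funext ⟨t, ht⟩
  have ht' : ¬ 1 < (t : ℝ) := not_lt.2 ht
  change v1ex4 t = v2ex4 t
  simp [v1ex4, v2ex4, ht']

lemma main_iff (ρ : ℝ) :
    (NnaNE Vex4 Uex4 {{t : Tex4 | (t : ℝ) ≤ 1}} (αex4 ρ)).Nonempty ↔ -(7/2 : ℝ) ≤ ρ := by
  have m1 : v1ex4 ∈ Vex4 := Or.inl rfl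
  have m2 : v2ex4 ∈ Vex4 := Or.inr rfl
  constructor
  · rintro ⟨z, ⟨hna, hsel⟩, hne⟩
    obtain ⟨u1, hu1⟩ := hne ⟨v1ex4, m1⟩
    have hA := hna Aex4 rfl ⟨v1ex4, m1⟩ ⟨v2ex4, m2⟩ restr_eq
    have hm : Aex4.restrict (u1 : Tex4 → ℝ) ∈ resSet Aex4 (z ⟨v1ex4, m1⟩) := ⟨u1, hu1, rfl⟩
    rw [hA] at hm
    obtain ⟨u2, hu2, heq⟩ := hm
    have h1 : -ρ ≤ |∫ t, ((u1 : Tex4 → ℝ) t + v1ex4 t) ∂muex4| := hsel _ hu1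
    have h2 : -ρ ≤ |∫ t, ((u2 : Tex4 → ℝ) t + v2ex4 t) ∂muex4| := hsel _ hu2
    rw [split1 _ u1.2] at h1
    rw [split2 _ u2.2] at h2
    have hc : ∫ t in Aex4, (u2 : Tex4 → ℝ) t ∂muex4 = ∫ t in Aex4, (u1 : Tex4 → ℝ) t ∂muex4 :=
      setIntegral_congr_fun measA (fun t ht => congrFun heq ⟨t, ht⟩)
    rw [hc] at h2
    have b0 := bound _ u1.2 Aex4
    have b1 := bound _ u1.2 Aex4ᶜ
    have b2 := bound _ u2.2 Aex4ᶜ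
    rw [muA] at b0
    rw [muAc] at b1 b2
    rw [abs_le] at b0 b1 b2
    rw [le_abs] at h1 h2
    rcases h1 with h1 | h1 <;> rcases h2 with h2 | h2 <;> linarith [b0.1, b0.2, b1.1, b1.2, b2.1, b2.2]
  · intro hρ
    have hne : ∀ ω : ↥Vex4, ∃ u ∈ αex4 ρ ω, ∀ t ∈ Aex4, (u : Tex4 → ℝ) t = 1/2 := by
      rintro ⟨ω, rfl | rfl⟩
      · have hm := uex4_mem 1 (by constructor <;> norm_num)
        refine ⟨⟨uex4 1, hm⟩, ?_, fun t ht => if_pos ht⟩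
        change -ρ ≤ |∫ t, (uex4 1 t + v1ex4 t) ∂muex4|
        rw [split1 _ hm, uex4_A, uex4_Ac, le_abs]
        left; linarith
      · have hm := uex4_mem (-1) (by constructor <;> norm_num)
        refine ⟨⟨uex4 (-1), hm⟩, ?_, fun t ht => if_pos ht⟩
        change -ρ ≤ |∫ t, (uex4 (-1) t + v2ex4 t) ∂muex4|
        rw [split2 _ hm, uex4_A, uex4_Ac, le_abs]
        right; linarith
    have hsub : ∀ ω ω' : ↥Vex4,
        resSet Aex4 {u ∈ αex4 ρ ω | ∀ t ∈ Aex4, (u : Tex4 → ℝ) t = 1/2} ⊆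
        resSet Aex4 {u ∈ αex4 ρ ω' | ∀ t ∈ Aex4, (u : Tex4 → ℝ) t = 1/2} := by
      rintro ω ω' _ ⟨u, ⟨_, hu⟩, rfl⟩
      obtain ⟨u', hu', hu2⟩ := hne ω'
      refine ⟨u', ⟨hu', hu2⟩, ?_⟩
      ext ⟨t, ht⟩
      exact (hu2 t ht).trans (hu t ht).symm
    refine ⟨fun ω => {u ∈ αex4 ρ ω | ∀ t ∈ Aex4, (u : Tex4 → ℝ) t = 1/2}, ⟨?_, ?_⟩, ?_⟩
    · rintro A rfl ω ω' _
      exact (hsub ω ω').antisymm (hsub ω' ω)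
    · exact fun ω u hu => hu.1
    · exact fun ω => hne ω

/-- In Example 4, `α_ρ` has a `{[0,1]}`-non-anticipative multiselector with
nonempty values iff `ρ ≥ -7/2`; in particular the optimal guaranteed result in the class of
non-anticipative strategies equals `-7/2`. -/
theorem stmt19 :
    (∀ ρ : ℝ,
      (NnaNE Vex4 Uex4 {{t : Tex4 | (t : ℝ) ≤ 1}} (αex4 ρ)).Nonempty ↔ -(7/2 : ℝ) ≤ ρ) ∧
    IsLeast {ρ : ℝ | (NnaNE Vex4 Uex4 {{t : Tex4 | (t : ℝ) ≤ 1}} (αex4 ρ)).Nonempty}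
      (-(7/2 : ℝ)) := by
  exact ⟨main_iff, (main_iff _).2 le_rfl, fun ρ h => (main_iff ρ).1 h⟩
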